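/- Let f : ¹E → ²E be a morphism of first-quadrant cohomological spectral sequences and let k ≥ 1 be an integer such that ¹E_{k+2}^{0,k} = 0. If f_2^{p,k−p} is surjective for all 0 ≤ p ≤ k−1 and f_2^{p,k+1−p} is injective for all p ≥ 2, then f_2^{0,k} : ¹E_2^{0,k} → ²E_2^{0,k} is injective. -/

import Mathlib

/-!
Statement 12: injectivity of `f_2^{0,k}` under the stated surjectivity/injectivity
hypotheses, when `¹E_{k+2}^{0,k} = 0`.
-/

universe u

/-- The underlying data of a first-quadrant cohomological spectral sequence of ℚ-vector
spaces, starting at page `2`: pages `E r p q` (only the pages with `r ≥ 2` are relevant),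
differentials `d_r : E_r^{p,q} → E_r^{p+r,q-r+1}` squaring to zero, and vanishing outside
the first quadrant. -/
structure FQSSAux where
  E : ℤ → ℤ → ℤ → Type u
  [addCommGroup : ∀ r p q, AddCommGroup (E r p q)]
  [module : ∀ r p q, Module ℚ (E r p q)]
  d : ∀ r p q : ℤ, E r p q →ₗ[ℚ] E r (p + r) (q - r + 1)
  d_comp_d : ∀ r p q : ℤ, (d r (p + r) (q - r + 1)).comp (d r p q) = 0
  firstQuadrant : ∀ r p q : ℤ, (p < 0 ∨ q < 0) → ∀ x : E r p q, x = 0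

attribute [instance] FQSSAux.addCommGroup FQSSAux.module

namespace FQSSAux

variable (S : FQSSAux)

/-- Transport between pages along equalities of the indices. -/
def castE {r p q r' p' q' : ℤ} (hr : r = r') (hp : p = p') (hq : q = q') :
    S.E r p q ≃ₗ[ℚ] S.E r' p' q' := by
  subst hr; subst hp; subst hq; exact LinearEquiv.refl ℚ _

/-- The cycles at position `(p,q)` of page `r`. -/
def cycles (r p q : ℤ) : Submodule ℚ (S.E r p q) := LinearMap.ker (S.d r p q)

/-- The boundaries at position `(p,q)` of page `r`: the image of the incoming
differential `d_r : E_r^{p-r,q+r-1} → E_r^{p,q}`. -/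
def boundaries (r p q : ℤ) : Submodule ℚ (S.E r p q) :=
  LinearMap.range ((S.castE rfl (by ring) (by ring) :
      S.E r (p - r + r) (q + r - 1 - r + 1) ≃ₗ[ℚ] S.E r p q).toLinearMap ∘ₗ
    S.d r (p - r) (q + r - 1))

/-- The homology `ker(d_r^{p,q}) / im(d_r^{p-r,q+r-1})` at position `(p,q)` of page `r`. -/
def homology (r p q : ℤ) : Type u :=
  ↥(S.cycles r p q) ⧸ (S.boundaries r p q).comap (S.cycles r p q).subtype

instance (r p q : ℤ) : AddCommGroup (S.homology r p q) :=
  inferInstanceAs (AddCommGroup (↥(S.cycles r p q) ⧸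
    (S.boundaries r p q).comap (S.cycles r p q).subtype))

instance (r p q : ℤ) : Module ℚ (S.homology r p q) :=
  inferInstanceAs (Module ℚ (↥(S.cycles r p q) ⧸
    (S.boundaries r p q).comap (S.cycles r p q).subtype))

/-- The class in homology of a cycle. -/
def homologyMk (r p q : ℤ) (x : S.E r p q) (hx : x ∈ S.cycles r p q) :
    S.homology r p q :=
  Submodule.Quotient.mk (⟨x, hx⟩ : ↥(S.cycles r p q))

end FQSSAux

/-- A first-quadrant cohomological spectral sequence of ℚ-vector spaces starting at page 2:
the underlying data together with identifications of each page `r + 1` (for `r ≥ 2`) with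
the homology of page `r`. -/
structure FQSS extends FQSSAux.{u} where
  next : ∀ r p q : ℤ, 2 ≤ r →
    toFQSSAux.E (r + 1) p q ≃ₗ[ℚ] toFQSSAux.homology r p q


/-- A morphism of first-quadrant cohomological spectral sequences: maps of pages commuting
with the differentials, such that the map on page `r + 1` is the one induced on homology by
the map on page `r`. -/
structure FQSSHom (A B : FQSS) where
  f : ∀ r p q : ℤ, A.E r p q →ₗ[ℚ] B.E r p q
  comm : ∀ r p q : ℤ,
    (f r (p + r) (q - r + 1)).comp (A.d r p q) = (B.d r p q).comp (f r p q)
  compat : ∀ (r p q : ℤ) (hr : 2 ≤ r) (x : A.E r p q) (hx : x ∈ A.cycles r p q),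
    f (r + 1) p q ((A.next r p q hr).symm (A.homologyMk r p q x hx)) =
      (B.next r p q hr).symm (B.homologyMk r p q (f r p q x) (by
        have h : (B.d r p q) (f r p q x) = (f r (p + r) (q - r + 1)) (A.d r p q x) := by
          have h' := congrArg
            (fun g : A.E r p q →ₗ[ℚ] B.E r (p + r) (q - r + 1) => g x) (comm r p q)
          simpa [LinearMap.comp_apply] using h'.symm
        have hx0 : A.d r p q x = 0 := hx
        show f r p q x ∈ LinearMap.ker (B.d r p q)
        rw [LinearMap.mem_ker, h, hx0, map_zero]))

namespace FQSS

/-- One step of the edge quotient map on the bottom row: since all differentials leaving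
the bottom row vanish, `E_{r+1}^{p,0}` is a quotient of `E_r^{p,0}`. -/
noncomputable def edgeStep (S : FQSS) (r p : ℤ) (hr : 2 ≤ r) :
    S.E r p 0 →ₗ[ℚ] S.E (r + 1) p 0 :=
  (S.next r p 0 hr).symm.toLinearMap ∘ₗ
    (Submodule.mkQ ((S.boundaries r p 0).comap (S.cycles r p 0).subtype)) ∘ₗ
    LinearMap.codRestrict (S.cycles r p 0) LinearMap.id (fun x => by
      show LinearMap.id x ∈ LinearMap.ker (S.d r p 0)
      rw [LinearMap.mem_ker]
      exact S.firstQuadrant r (p + r) (0 - r + 1) (Or.inr (by linarith)) _)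

/-- The iterated edge map `E_2^{p,0} → E_{2+m}^{p,0}` on the bottom row. -/
noncomputable def edgeFromNat (S : FQSS) (p : ℤ) :
    (m : ℕ) → (S.E 2 p 0 →ₗ[ℚ] S.E (2 + (m : ℤ)) p 0)
  | 0 => (S.castE (by norm_num) rfl rfl).toLinearMap
  | (m + 1) =>
      (S.castE (by push_cast; ring) rfl rfl).toLinearMap ∘ₗ
        (S.edgeStep (2 + (m : ℤ)) p (by omega)) ∘ₗ S.edgeFromNat p m

/-- The edge homomorphism `E_2^{p,0} → E_r^{p,0}` (for `r ≥ 2`) on the bottom row: the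
composite of the quotient maps `E_s^{p,0} → E_{s+1}^{p,0}` for `2 ≤ s < r`. -/
noncomputable def edge (S : FQSS) (p r : ℤ) (hr : 2 ≤ r) :
    S.E 2 p 0 →ₗ[ℚ] S.E r p 0 :=
  (S.castE (by omega) rfl rfl :
      S.E (2 + (((r - 2).toNat : ℕ) : ℤ)) p 0 ≃ₗ[ℚ] S.E r p 0).toLinearMap ∘ₗ
    S.edgeFromNat p (r - 2).toNat

end FQSS

theorem FQSS.mk_eq_zero (S : FQSS) (r p q : ℤ) (hr : 2 ≤ r) (x : S.E r p q)
    (hx : x ∈ S.cycles r p q) :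
    (S.next r p q hr).symm (S.homologyMk r p q x hx) = 0 ↔ x ∈ S.boundaries r p q := by
  rw [LinearEquiv.map_eq_zero_iff]
  exact Submodule.Quotient.mk_eq_zero _

theorem FQSS.exists_mk (S : FQSS) (r p q : ℤ) (hr : 2 ≤ r) (z : S.E (r + 1) p q) :
    ∃ (x : S.E r p q) (hx : x ∈ S.cycles r p q),
      z = (S.next r p q hr).symm (S.homologyMk r p q x hx) := by
  obtain ⟨⟨x, hx⟩, h⟩ := Submodule.Quotient.mk_surjective _ (S.next r p q hr z)
  refine ⟨x, hx, ?_⟩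
  rw [LinearEquiv.eq_symm_apply]
  exact h.symm

theorem FQSSHom.f_castE {A B : FQSS} (φ : FQSSHom A B) {r p q r' p' q' : ℤ} (hr : r = r')
    (hp : p = p') (hq : q = q') (x : A.E r p q) :
    φ.f r' p' q' (A.castE hr hp hq x) = B.castE hr hp hq (φ.f r p q x) := by
  subst hr; subst hp; subst hq; rfl

theorem FQSSHom.comm_apply {A B : FQSS} (φ : FQSSHom A B) (r p q : ℤ) (x : A.E r p q) :
    φ.f r (p + r) (q - r + 1) (A.d r p q x) = B.d r p q (φ.f r p q x) :=
  LinearMap.congr_fun (φ.comm r p q) x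

theorem FQSSHom.pages {A B : FQSS} (φ : FQSSHom A B) (k : ℤ)
    (hsurj : ∀ p q : ℤ, p + q = k → 0 ≤ p → p ≤ k - 1 → Function.Surjective (φ.f 2 p q))
    (hinj : ∀ p q : ℤ, p + q = k + 1 → 2 ≤ p → Function.Injective (φ.f 2 p q))
    (r : ℤ) (hr : 2 ≤ r) :
    (∀ p q : ℤ, p + q = k → 0 ≤ p → p ≤ k - 1 → Function.Surjective (φ.f r p q)) ∧
    (∀ p q : ℤ, p + q = k + 1 → 2 ≤ p → Function.Injective (φ.f r p q)) := by
  induction r, hr using Int.le_induction with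
  | base => exact ⟨hsurj, hinj⟩
  | succ r hr ih =>
    obtain ⟨hs, hi⟩ := ih
    constructor
    · intro p q hpq hp0 hpk z
      obtain ⟨y, hy, rfl⟩ := B.exists_mk r p q hr z
      obtain ⟨x, rfl⟩ := hs p q hpq hp0 hpk y
      have hx : x ∈ A.cycles r p q := by
        change A.d r p q x = 0
        apply hi (p + r) (q - r + 1) (by omega) (by omega)
        rw [φ.comm_apply, map_zero]
        exact hy
      exact ⟨_, φ.compat r p q hr x hx⟩
    · intro p q hpq hp
      rw [injective_iff_map_eq_zero]
      intro z hz
      obtain ⟨x, hx, rfl⟩ := A.exists_mk r p q hr z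
      rw [φ.compat, FQSS.mk_eq_zero] at hz
      rw [FQSS.mk_eq_zero]
      by_cases hq : q < 0
      · rw [A.firstQuadrant r p q (Or.inr hq) x]
        exact Submodule.zero_mem _
      obtain ⟨y, hy⟩ := hz
      have hy' : ∃ y', φ.f r (p - r) (q + r - 1) y' = y := by
        by_cases hpr : p - r < 0
        · exact ⟨0, by rw [map_zero, B.firstQuadrant r _ _ (Or.inl hpr) y]⟩
        · exact hs _ _ (by omega) (by omega) (by omega) y
      obtain ⟨y', rfl⟩ := hy'
      refine ⟨y', hi p q hpq hp ?_⟩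
      rw [← hy]
      simp only [LinearMap.comp_apply, LinearEquiv.coe_coe]
      rw [φ.f_castE, φ.comm_apply]

theorem statement_12 (A B : FQSS) (φ : FQSSHom A B) (k : ℤ) (hk : 1 ≤ k)
    (hA : ∀ x : A.E (k + 2) 0 k, x = 0)
    (hsurj : ∀ p : ℤ, 0 ≤ p → p ≤ k - 1 → Function.Surjective (φ.f 2 p (k - p)))
    (hinj : ∀ p : ℤ, 2 ≤ p → Function.Injective (φ.f 2 p (k + 1 - p))) :
    Function.Injective (φ.f 2 0 k) := by
  have hP := φ.pages k
    (fun p q h h0 h1 => by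
      obtain rfl : q = k - p := by omega
      exact hsurj p h0 h1)
    (fun p q h h0 => by
      obtain rfl : q = k + 1 - p := by omega
      exact hinj p h0)
  have key : ∀ n : ℕ, ∀ r : ℤ, 2 ≤ r → r + n = k + 2 →
      Function.Injective (φ.f r 0 k) := by
    intro n
    induction n with
    | zero =>
      intro r hr h
      obtain rfl : r = k + 2 := by simpa using h
      intro x y _
      rw [hA x, hA y]
    | succ n ih =>
      intro r hr h
      have hnext := ih (r + 1) (by omega) (by push_cast at h; omega)
      rw [injective_iff_map_eq_zero]
      intro x hx
      have hc : x ∈ A.cycles r 0 k := by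
        change A.d r 0 k x = 0
        apply (hP r hr).2 (0 + r) (k - r + 1) (by omega) (by omega)
        rw [φ.comm_apply, hx, map_zero, map_zero]
      have hz : (A.next r 0 k hr).symm (A.homologyMk r 0 k x hc) = 0 := by
        apply hnext
        rw [(φ.f (r + 1) 0 k).map_zero, φ.compat, FQSS.mk_eq_zero, hx]
        exact Submodule.zero_mem _
      rw [FQSS.mk_eq_zero] at hz
      obtain ⟨y, rfl⟩ := hz
      rw [A.firstQuadrant r _ _ (Or.inl (by omega)) y, map_zero]
  exact key k.toNat 2 le_rfl (by omega)
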